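/- In a differential linear category with antiderivatives, writing s_R : !R → !R for the unit component of the antiderivative integral transformation, the following formulas hold for every object A: (i) K_A⁻¹ = (m_R ⊗ m_R ⊗ 1_{!A})(s_R ⊗ s_R ⊗ 1_{!A})(m_{R,R} ⊗ 1_{!A})(d_R ⊗ 1_{!A}) m_{R,A} + !(0); (ii) J_A⁻¹ = (m_R ⊗ 1_{!A})(s_R ⊗ 1_{!A}) m_{R,A}; (iii) s_A = (m_R ⊗ 1_{!A})(s_R ⊗ d°_A)(m_{R,A} ⊗ 1_A). -/

import Mathlib

universe u v

/-- A symmetric strict monoidal category (data and the coherence axioms that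
do not require transport along object equalities). Composition `comp f g`
is in diagrammatic order: first `f`, then `g`. -/
structure SMCData where
  Obj : Type u
  Hom : Obj → Obj → Type v
  id : ∀ A : Obj, Hom A A
  comp : ∀ {A B C : Obj}, Hom A B → Hom B C → Hom A C
  id_comp : ∀ {A B : Obj} (f : Hom A B), comp (id A) f = f
  comp_id : ∀ {A B : Obj} (f : Hom A B), comp f (id B) = f
  comp_assoc : ∀ {A B C D : Obj} (f : Hom A B) (g : Hom B C) (h : Hom C D),
    comp (comp f g) h = comp f (comp g h)
  ten : Obj → Obj → Obj
  unit : Obj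
  tHom : ∀ {A B C D : Obj}, Hom A C → Hom B D → Hom (ten A B) (ten C D)
  tHom_id : ∀ (A B : Obj), tHom (id A) (id B) = id (ten A B)
  tHom_comp : ∀ {A₁ A₂ A₃ B₁ B₂ B₃ : Obj} (f : Hom A₁ A₂) (g : Hom A₂ A₃)
    (f' : Hom B₁ B₂) (g' : Hom B₂ B₃),
    tHom (comp f g) (comp f' g') = comp (tHom f f') (tHom g g')
  tenAssoc : ∀ (A B C : Obj), ten (ten A B) C = ten A (ten B C)
  unit_ten : ∀ (A : Obj), ten unit A = A
  ten_unit : ∀ (A : Obj), ten A unit = A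
  sw : ∀ (A B : Obj), Hom (ten A B) (ten B A)
  sw_natural : ∀ {A B C D : Obj} (f : Hom A C) (g : Hom B D),
    comp (tHom f g) (sw C D) = comp (sw A B) (tHom g f)
  sw_sw : ∀ (A B : Obj), comp (sw A B) (sw B A) = id (ten A B)

/-- The identity morphism transported along an equality of objects. In a
strict monoidal category the structural isomorphisms are identities, so these
are used to express the strictness identifications. -/
def SMCData.cHom (C : SMCData) {A B : C.Obj} (h : A = B) : C.Hom A B := by
  cases h; exact C.id A
/-- A differential linear category: a differential category whose coalgebra modality is a monoidal coalgebra modality. -/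
structure DiffLinCat extends SMCData where
  -- strictness coherence: associativity and unit identifications are
  -- (transported) identities compatible with the tensor of morphisms,
  -- and the symmetry satisfies the (strict) hexagon identity
  assoc_natural : ∀ {A₁ A₂ B₁ B₂ C₁ C₂ : Obj} (f : Hom A₁ A₂) (g : Hom B₁ B₂) (h : Hom C₁ C₂),
    comp (tHom (tHom f g) h) (toSMCData.cHom (tenAssoc A₂ B₂ C₂)) =
      comp (toSMCData.cHom (tenAssoc A₁ B₁ C₁)) (tHom f (tHom g h))
  unit_ten_natural : ∀ {A B : Obj} (f : Hom A B),
    comp (tHom (id unit) f) (toSMCData.cHom (unit_ten B)) =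
      comp (toSMCData.cHom (unit_ten A)) f
  ten_unit_natural : ∀ {A B : Obj} (f : Hom A B),
    comp (tHom f (id unit)) (toSMCData.cHom (ten_unit B)) =
      comp (toSMCData.cHom (ten_unit A)) f
  hexagon : ∀ (A B C : Obj),
    comp (toSMCData.cHom (tenAssoc A B C))
      (comp (tHom (id A) (sw B C))
        (comp (toSMCData.cHom (tenAssoc A C B).symm)
          (comp (tHom (sw A C) (id B)) (toSMCData.cHom (tenAssoc C A B))))) =
      sw (ten A B) C
  -- additive enrichment: hom-sets are commutative monoids and composition
  -- and tensor preserve the additive structure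
  add : ∀ {A B : Obj}, Hom A B → Hom A B → Hom A B
  zero : ∀ {A B : Obj}, Hom A B
  add_assoc : ∀ {A B : Obj} (f g h : Hom A B), add (add f g) h = add f (add g h)
  add_comm : ∀ {A B : Obj} (f g : Hom A B), add f g = add g f
  add_zero : ∀ {A B : Obj} (f : Hom A B), add f zero = f
  comp_add : ∀ {A B C : Obj} (f : Hom A B) (g h : Hom B C),
    comp f (add g h) = add (comp f g) (comp f h)
  add_comp : ∀ {A B C : Obj} (f g : Hom A B) (h : Hom B C),
    comp (add f g) h = add (comp f h) (comp g h)
  comp_zero : ∀ {A B C : Obj} (f : Hom A B), comp f (zero : Hom B C) = zero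
  zero_comp : ∀ {A B C : Obj} (f : Hom B C), comp (zero : Hom A B) f = zero
  tHom_add_left : ∀ {A B C D : Obj} (f g : Hom A C) (h : Hom B D),
    tHom (add f g) h = add (tHom f h) (tHom g h)
  tHom_add_right : ∀ {A B C D : Obj} (f : Hom A C) (g h : Hom B D),
    tHom f (add g h) = add (tHom f g) (tHom f h)
  tHom_zero_left : ∀ {A B C D : Obj} (h : Hom B D),
    tHom (zero : Hom A C) h = zero
  tHom_zero_right : ∀ {A B C D : Obj} (f : Hom A C),
    tHom f (zero : Hom B D) = zero
  -- a coalgebra modality: a comonad (bang, rho, eps) with natural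
  -- cocommutative comonoid structure (cmul, cunit) on each bang A,
  -- for which each rho A is a comonoid morphism
  bang : Obj → Obj
  bangMap : ∀ {A B : Obj}, Hom A B → Hom (bang A) (bang B)
  bangMap_id : ∀ (A : Obj), bangMap (id A) = id (bang A)
  bangMap_comp : ∀ {A B C : Obj} (f : Hom A B) (g : Hom B C),
    bangMap (comp f g) = comp (bangMap f) (bangMap g)
  rho : ∀ (A : Obj), Hom (bang A) (bang (bang A))
  eps : ∀ (A : Obj), Hom (bang A) A
  cmul : ∀ (A : Obj), Hom (bang A) (ten (bang A) (bang A))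
  cunit : ∀ (A : Obj), Hom (bang A) unit
  rho_natural : ∀ {A B : Obj} (f : Hom A B),
    comp (bangMap f) (rho B) = comp (rho A) (bangMap (bangMap f))
  eps_natural : ∀ {A B : Obj} (f : Hom A B),
    comp (bangMap f) (eps B) = comp (eps A) f
  cmul_natural : ∀ {A B : Obj} (f : Hom A B),
    comp (bangMap f) (cmul B) = comp (cmul A) (tHom (bangMap f) (bangMap f))
  cunit_natural : ∀ {A B : Obj} (f : Hom A B),
    comp (bangMap f) (cunit B) = cunit A
  rho_eps : ∀ (A : Obj), comp (rho A) (eps (bang A)) = id (bang A)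
  rho_bangMap_eps : ∀ (A : Obj), comp (rho A) (bangMap (eps A)) = id (bang A)
  rho_rho : ∀ (A : Obj), comp (rho A) (rho (bang A)) = comp (rho A) (bangMap (rho A))
  cmul_coassoc : ∀ (A : Obj),
    comp (cmul A) (comp (tHom (cmul A) (id (bang A)))
      (toSMCData.cHom (tenAssoc (bang A) (bang A) (bang A)))) =
    comp (cmul A) (tHom (id (bang A)) (cmul A))
  cmul_counit_left : ∀ (A : Obj),
    comp (cmul A) (comp (tHom (cunit A) (id (bang A)))
      (toSMCData.cHom (unit_ten (bang A)))) = id (bang A)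
  cmul_counit_right : ∀ (A : Obj),
    comp (cmul A) (comp (tHom (id (bang A)) (cunit A))
      (toSMCData.cHom (ten_unit (bang A)))) = id (bang A)
  cmul_cocomm : ∀ (A : Obj), comp (cmul A) (sw (bang A) (bang A)) = cmul A
  rho_cmul : ∀ (A : Obj),
    comp (rho A) (cmul (bang A)) = comp (cmul A) (tHom (rho A) (rho A))
  rho_cunit : ∀ (A : Obj), comp (rho A) (cunit (bang A)) = cunit A
  -- a deriving transformation [d.1]-[d.5]
  der : ∀ (A : Obj), Hom (ten (bang A) A) (bang A)
  der_natural : ∀ {A B : Obj} (f : Hom A B),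
    comp (tHom (bangMap f) f) (der B) = comp (der A) (bangMap f)
  -- [d.1] constant rule
  der_cunit : ∀ (A : Obj), comp (der A) (cunit A) = zero
  -- [d.2] Leibniz rule
  der_cmul : ∀ (A : Obj),
    comp (der A) (cmul A) =
      add
        (comp (tHom (cmul A) (id A))
          (comp (toSMCData.cHom (tenAssoc (bang A) (bang A) A))
            (comp (tHom (id (bang A)) (sw (bang A) A))
              (comp (toSMCData.cHom (tenAssoc (bang A) A (bang A)).symm)
                (tHom (der A) (id (bang A)))))))
        (comp (tHom (cmul A) (id A))
          (comp (toSMCData.cHom (tenAssoc (bang A) (bang A) A))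
            (tHom (id (bang A)) (der A))))
  -- [d.3] linear rule
  der_eps : ∀ (A : Obj),
    comp (der A) (eps A) = comp (tHom (cunit A) (id A)) (toSMCData.cHom (unit_ten A))
  -- [d.4] chain rule
  der_rho : ∀ (A : Obj),
    comp (der A) (rho A) =
      comp (tHom (cmul A) (id A))
        (comp (toSMCData.cHom (tenAssoc (bang A) (bang A) A))
          (comp (tHom (rho A) (der A)) (der (bang A))))
  -- [d.5] interchange rule
  der_interchange : ∀ (A : Obj),
    comp (tHom (der A) (id A)) (der A) =
      comp (toSMCData.cHom (tenAssoc (bang A) A A))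
        (comp (tHom (id (bang A)) (sw A A))
          (comp (toSMCData.cHom (tenAssoc (bang A) A A).symm)
            (comp (tHom (der A) (id A)) (der A))))
  -- monoidal coalgebra modality structure: (bang, m, mUnit) is a symmetric
  -- monoidal functor, rho, eps, cmul, cunit are monoidal transformations and
  -- cmul, cunit are bang-coalgebra morphisms
  m : ∀ (A B : Obj), Hom (ten (bang A) (bang B)) (bang (ten A B))
  mUnit : Hom unit (bang unit)
  m_natural : ∀ {A A' B B' : Obj} (f : Hom A A') (g : Hom B B'),
    comp (tHom (bangMap f) (bangMap g)) (m A' B') = comp (m A B) (bangMap (tHom f g))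
  m_assoc : ∀ (A B C : Obj),
    comp (tHom (m A B) (id (bang C)))
      (comp (m (ten A B) C) (bangMap (toSMCData.cHom (tenAssoc A B C)))) =
    comp (toSMCData.cHom (tenAssoc (bang A) (bang B) (bang C)))
      (comp (tHom (id (bang A)) (m B C)) (m A (ten B C)))
  m_unit_left : ∀ (A : Obj),
    comp (toSMCData.cHom (unit_ten (bang A)).symm)
      (comp (tHom mUnit (id (bang A)))
        (comp (m unit A) (bangMap (toSMCData.cHom (unit_ten A))))) = id (bang A)
  m_unit_right : ∀ (A : Obj),
    comp (toSMCData.cHom (ten_unit (bang A)).symm)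
      (comp (tHom (id (bang A)) mUnit)
        (comp (m A unit) (bangMap (toSMCData.cHom (ten_unit A))))) = id (bang A)
  m_sw : ∀ (A B : Obj),
    comp (sw (bang A) (bang B)) (m B A) = comp (m A B) (bangMap (sw A B))
  m_rho : ∀ (A B : Obj),
    comp (m A B) (rho (ten A B)) =
      comp (tHom (rho A) (rho B)) (comp (m (bang A) (bang B)) (bangMap (m A B)))
  mUnit_rho : comp mUnit (rho unit) = comp mUnit (bangMap mUnit)
  m_eps : ∀ (A B : Obj), comp (m A B) (eps (ten A B)) = tHom (eps A) (eps B)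
  mUnit_eps : comp mUnit (eps unit) = id unit
  m_cmul : ∀ (A B : Obj),
    comp (m A B) (cmul (ten A B)) =
      comp (tHom (cmul A) (cmul B))
        (comp (toSMCData.cHom (tenAssoc (bang A) (bang A) (ten (bang B) (bang B))))
          (comp (tHom (id (bang A)) (toSMCData.cHom (tenAssoc (bang A) (bang B) (bang B)).symm))
            (comp (tHom (id (bang A)) (tHom (sw (bang A) (bang B)) (id (bang B))))
              (comp (tHom (id (bang A)) (toSMCData.cHom (tenAssoc (bang B) (bang A) (bang B))))
                (comp (toSMCData.cHom (tenAssoc (bang A) (bang B) (ten (bang A) (bang B))).symm)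
                  (tHom (m A B) (m A B)))))))
  m_cunit : ∀ (A B : Obj),
    comp (m A B) (cunit (ten A B)) =
      comp (tHom (cunit A) (cunit B)) (toSMCData.cHom (unit_ten unit))
  mUnit_cmul : comp mUnit (cmul unit) =
    comp (toSMCData.cHom (unit_ten unit).symm) (tHom mUnit mUnit)
  mUnit_cunit : comp mUnit (cunit unit) = id unit
  cmul_coalg : ∀ (A : Obj),
    comp (rho A) (bangMap (cmul A)) =
      comp (cmul A) (comp (tHom (rho A) (rho A)) (m (bang A) (bang A)))
  cunit_coalg : ∀ (A : Obj),
    comp (rho A) (bangMap (cunit A)) = comp (cunit A) mUnit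

def DiffLinCat.cHom (C : DiffLinCat) {A B : C.Obj} (h : A = B) : C.Hom A B :=
  C.toSMCData.cHom h

namespace DiffLinCat

variable (C : DiffLinCat)

/-- The coderiving transformation d°_A := Δ_A (1 ⊗ ε_A). -/
def dcirc (A : C.Obj) : C.Hom (C.bang A) (C.ten (C.bang A) A) :=
  C.comp (C.cmul A) (C.tHom (C.id (C.bang A)) (C.eps A))

/-- K_A := d°_A d_A + !(0). -/
def K (A : C.Obj) : C.Hom (C.bang A) (C.bang A) :=
  C.add (C.comp (C.dcirc A) (C.der A)) (C.bangMap (C.zero : C.Hom A A))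

/-- J_A := d°_A d_A + 1_{!A}. -/
def J (A : C.Obj) : C.Hom (C.bang A) (C.bang A) :=
  C.add (C.comp (C.dcirc A) (C.der A)) (C.id (C.bang A))

/-- The deriving transformation at the monoidal unit, under the strictness
identification !R ⊗ R = !R. -/
def dR : C.Hom (C.bang C.unit) (C.bang C.unit) :=
  C.comp (C.cHom (C.ten_unit (C.bang C.unit)).symm) (C.der C.unit)

/-- The coderiving transformation at the monoidal unit, under the strictness
identification !R ⊗ R = !R. -/
def dcircR : C.Hom (C.bang C.unit) (C.bang C.unit) :=
  C.comp (C.dcirc C.unit) (C.cHom (C.ten_unit (C.bang C.unit)))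

end DiffLinCat

/-- The multiplication m_{R,R} : !R ⊗ !R → !R, under the strictness
identification R ⊗ R = R. -/
def DiffLinCat.mRR (C : DiffLinCat) :
    C.Hom (C.ten (C.bang C.unit) (C.bang C.unit)) (C.bang C.unit) :=
  C.comp (C.m C.unit C.unit) (C.bangMap (C.cHom (C.unit_ten C.unit)))

/-- The map m_{R,A} : !R ⊗ !A → !A, under the strictness identification
R ⊗ A = A. -/
def DiffLinCat.mRA (C : DiffLinCat) (A : C.Obj) :
    C.Hom (C.ten (C.bang C.unit) (C.bang A)) (C.bang A) :=
  C.comp (C.m C.unit A) (C.bangMap (C.cHom (C.unit_ten A)))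

/-- The unit component of the antiderivative integral transformation,
s_R := K_R⁻¹ d°_R, under the strictness identification !R ⊗ R = !R. -/
def DiffLinCat.sRof (C : DiffLinCat)
    (Kinv : ∀ A : C.Obj, C.Hom (C.bang A) (C.bang A)) :
    C.Hom (C.bang C.unit) (C.bang C.unit) :=
  C.comp (Kinv C.unit) C.dcircR

open CategoryTheory MonoidalCategory

namespace SMCData

variable (C : SMCData.{u, v})

instance : Category C.Obj where
  Hom := C.Hom
  id := C.id
  comp := C.comp
  id_comp := C.id_comp
  comp_id := C.comp_id
  assoc := C.comp_assoc

theorem cHom_eq_eqToHom {X Y : C.Obj} (h : X = Y) : C.cHom h = eqToHom h := by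
  cases h; rfl

/-- The isomorphism given by transport along an equality of objects. -/
@[simps]
def cIso {X Y : C.Obj} (h : X = Y) : X ≅ Y where
  hom := C.cHom h
  inv := C.cHom h.symm
  hom_inv_id := by simp [cHom_eq_eqToHom]
  inv_hom_id := by simp [cHom_eq_eqToHom]

end SMCData

namespace DiffLinCat

variable (C : DiffLinCat.{u, v})

instance : MonoidalCategoryStruct C.Obj where
  tensorObj := C.ten
  tensorUnit := C.unit
  tensorHom := C.tHom
  whiskerLeft X _ _ f := C.tHom (C.id X) f
  whiskerRight f Y := C.tHom f (C.id Y)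
  associator X Y Z := C.cIso (C.tenAssoc X Y Z)
  leftUnitor X := C.cIso (C.unit_ten X)
  rightUnitor X := C.cIso (C.ten_unit X)

theorem associator_hom_eq_eqToHom (X Y Z : C.Obj) :
    (α_ X Y Z).hom = eqToHom (C.tenAssoc X Y Z) := C.cHom_eq_eqToHom _

theorem leftUnitor_hom_eq_eqToHom (X : C.Obj) :
    (λ_ X).hom = eqToHom (C.unit_ten X) := C.cHom_eq_eqToHom _

theorem leftUnitor_inv_eq_eqToHom (X : C.Obj) :
    (λ_ X).inv = eqToHom (C.unit_ten X).symm := C.cHom_eq_eqToHom _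

theorem rightUnitor_hom_eq_eqToHom (X : C.Obj) :
    (ρ_ X).hom = eqToHom (C.ten_unit X) := C.cHom_eq_eqToHom _

theorem tensorHom_eqToHom {X Y X' Y' : C.Obj} (h : X = Y) (h' : X' = Y') :
    eqToHom h ⊗ₘ eqToHom h' = eqToHom (congrArg₂ C.ten h h') := by
  cases h; cases h'; exact C.tHom_id X X'

instance : MonoidalCategory C.Obj :=
  MonoidalCategory.ofTensorHom (fun X Y => C.tHom_id X Y) (fun _ _ _ _ => rfl)
    (fun _ _ => rfl) (fun f₁ f₂ g₁ g₂ => (C.tHom_comp f₁ g₁ f₂ g₂).symm) C.assoc_natural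
    C.unit_ten_natural C.ten_unit_natural
    (fun W X Y Z => by
      rw [← eqToHom_refl Z rfl, ← eqToHom_refl W rfl]
      simp only [associator_hom_eq_eqToHom, tensorHom_eqToHom, eqToHom_trans])
    (fun X Y => by
      rw [← eqToHom_refl X rfl, ← eqToHom_refl Y rfl]
      simp only [associator_hom_eq_eqToHom, leftUnitor_hom_eq_eqToHom,
        rightUnitor_hom_eq_eqToHom, tensorHom_eqToHom, eqToHom_trans])

theorem hexagon_sw (X Y Z : C.Obj) :
    (α_ X Y Z).hom ≫ X ◁ C.sw Y Z ≫ (α_ X Z Y).inv ≫ C.sw X Z ▷ Y ≫ (α_ Z X Y).hom =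
      C.sw (X ⊗ Y) Z :=
  C.hexagon X Y Z

theorem sw_comp_sw (X Y : C.Obj) : C.sw X Y ≫ C.sw Y X = 𝟙 (X ⊗ Y) := C.sw_sw X Y

instance : SymmetricCategory C.Obj where
  braiding X Y := ⟨C.sw X Y, C.sw Y X, C.sw_sw X Y, C.sw_sw Y X⟩
  braiding_naturality_right X _ _ f := C.sw_natural (𝟙 X) f
  braiding_naturality_left f Z := C.sw_natural f (𝟙 Z)
  hexagon_forward X Y Z := by
    change (α_ X Y Z).hom ≫ C.sw X (Y ⊗ Z) ≫ (α_ Y Z X).hom =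
      C.sw X Y ▷ Z ≫ (α_ Y X Z).hom ≫ Y ◁ C.sw X Z
    have key : C.sw (Y ⊗ Z) X ≫ ((α_ X Y Z).inv ≫ C.sw X Y ▷ Z ≫ (α_ Y X Z).hom ≫
        Y ◁ C.sw X Z ≫ (α_ Y Z X).inv) = 𝟙 _ := by
      rw [← hexagon_sw]
      simp only [Category.assoc, Iso.hom_inv_id_assoc, ← comp_whiskerRight_assoc, sw_comp_sw,
        id_whiskerRight, Category.id_comp, Iso.inv_hom_id_assoc, ← whiskerLeft_comp_assoc,
        whiskerLeft_id, Iso.hom_inv_id]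
    have hs : C.sw X (Y ⊗ Z) = (α_ X Y Z).inv ≫ C.sw X Y ▷ Z ≫ (α_ Y X Z).hom ≫
        Y ◁ C.sw X Z ≫ (α_ Y Z X).inv := by
      rw [← Category.id_comp ((α_ X Y Z).inv ≫ _), ← sw_comp_sw, Category.assoc, key,
        Category.comp_id]
    rw [hs]
    simp
  hexagon_reverse X Y Z := by
    change (α_ X Y Z).inv ≫ C.sw (X ⊗ Y) Z ≫ (α_ Z X Y).inv =
      X ◁ C.sw Y Z ≫ (α_ X Z Y).inv ≫ C.sw X Z ▷ Y
    rw [← hexagon_sw]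
    simp
  symmetry := C.sw_sw

instance (X Y : C.Obj) : AddCommMonoid (X ⟶ Y) where
  add := C.add
  add_assoc := C.add_assoc
  zero := C.zero
  zero_add f := (C.add_comm _ _).trans (C.add_zero f)
  add_zero := C.add_zero
  add_comm := C.add_comm
  nsmul := @nsmulRec _ ⟨C.zero⟩ ⟨C.add⟩

theorem comp_add_hom {X Y Z : C.Obj} (f : X ⟶ Y) (g h : Y ⟶ Z) :
    f ≫ (g + h) = f ≫ g + f ≫ h := C.comp_add f g h

theorem add_comp_hom {X Y Z : C.Obj} (f g : X ⟶ Y) (h : Y ⟶ Z) :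
    (f + g) ≫ h = f ≫ h + g ≫ h := C.add_comp f g h

theorem comp_zero_hom {X Y Z : C.Obj} (f : X ⟶ Y) : f ≫ (0 : Y ⟶ Z) = 0 := C.comp_zero f

theorem zero_comp_hom {X Y Z : C.Obj} (f : Y ⟶ Z) : (0 : X ⟶ Y) ≫ f = 0 := C.zero_comp f

theorem add_whiskerRight_hom {X Y : C.Obj} (f g : X ⟶ Y) (Z : C.Obj) :
    (f + g) ▷ Z = f ▷ Z + g ▷ Z := C.tHom_add_left f g (𝟙 Z)

theorem whiskerLeft_zero_hom (X Y Z : C.Obj) : X ◁ (0 : Y ⟶ Z) = 0 := C.tHom_zero_right (𝟙 X)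

theorem zero_whiskerRight_hom (X Y Z : C.Obj) : (0 : X ⟶ Y) ▷ Z = 0 := C.tHom_zero_left (𝟙 Z)

section structureMaps

/-- The action of `!` on morphisms. -/
def bangHom {X Y : C.Obj} (f : X ⟶ Y) : C.bang X ⟶ C.bang Y := C.bangMap f

/-- The comultiplication of the comonad `!`. -/
def rhoHom (X : C.Obj) : C.bang X ⟶ C.bang (C.bang X) := C.rho X

/-- The counit of the comonad `!`. -/
def epsHom (X : C.Obj) : C.bang X ⟶ X := C.eps X

/-- The comultiplication of the comonoid `!X`. -/
def cmulHom (X : C.Obj) : C.bang X ⟶ C.bang X ⊗ C.bang X := C.cmul X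

/-- The counit of the comonoid `!X`. -/
def cunitHom (X : C.Obj) : C.bang X ⟶ 𝟙_ C.Obj := C.cunit X

/-- The deriving transformation. -/
def derHom (X : C.Obj) : C.bang X ⊗ X ⟶ C.bang X := C.der X

/-- The lax monoidal structure of `!`. -/
def mHom (X Y : C.Obj) : C.bang X ⊗ C.bang Y ⟶ C.bang (X ⊗ Y) := C.m X Y

/-- The lax monoidal unit of `!`. -/
def mUnitHom : 𝟙_ C.Obj ⟶ C.bang (𝟙_ C.Obj) := C.mUnit

variable {C}

theorem bang_map_comp {X Y Z : C.Obj} (f : X ⟶ Y) (g : Y ⟶ Z) :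
    C.bangHom f ≫ C.bangHom g = C.bangHom (f ≫ g) := (C.bangMap_comp f g).symm

theorem bang_map_id (X : C.Obj) : C.bangHom (𝟙 X) = 𝟙 (C.bang X) := C.bangMap_id X

theorem bang_map_rho {X Y : C.Obj} (f : X ⟶ Y) :
    C.bangHom f ≫ C.rhoHom Y = C.rhoHom X ≫ C.bangHom (C.bangHom f) := C.rho_natural f

theorem bang_map_eps {X Y : C.Obj} (f : X ⟶ Y) :
    C.bangHom f ≫ C.epsHom Y = C.epsHom X ≫ f := C.eps_natural f

theorem bang_map_cmul {X Y : C.Obj} (f : X ⟶ Y) :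
    C.bangHom f ≫ C.cmulHom Y = C.cmulHom X ≫ (C.bangHom f ⊗ₘ C.bangHom f) := C.cmul_natural f

theorem bang_map_cunit {X Y : C.Obj} (f : X ⟶ Y) :
    C.bangHom f ≫ C.cunitHom Y = C.cunitHom X := C.cunit_natural f

theorem rho_comp_bang_map_eps (X : C.Obj) :
    C.rhoHom X ≫ C.bangHom (C.epsHom X) = 𝟙 (C.bang X) := C.rho_bangMap_eps X

theorem cmul_assoc (X : C.Obj) :
    C.cmulHom X ≫ C.cmulHom X ▷ C.bang X ≫ (α_ _ _ _).hom = C.cmulHom X ≫ C.bang X ◁ C.cmulHom X :=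
  C.cmul_coassoc X

theorem cmul_cunit_left (X : C.Obj) :
    C.cmulHom X ≫ C.cunitHom X ▷ C.bang X ≫ (λ_ _).hom = 𝟙 (C.bang X) := C.cmul_counit_left X

theorem cmul_cunit_right (X : C.Obj) :
    C.cmulHom X ≫ C.bang X ◁ C.cunitHom X ≫ (ρ_ _).hom = 𝟙 (C.bang X) := C.cmul_counit_right X

theorem cmul_braiding (X : C.Obj) :
    C.cmulHom X ≫ (β_ (C.bang X) (C.bang X)).hom = C.cmulHom X := C.cmul_cocomm X

theorem rho_comp_cmul (X : C.Obj) :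
    C.rhoHom X ≫ C.cmulHom (C.bang X) = C.cmulHom X ≫ (C.rhoHom X ⊗ₘ C.rhoHom X) := C.rho_cmul X

theorem tensor_der {X Y : C.Obj} (f : X ⟶ Y) :
    (C.bangHom f ⊗ₘ f) ≫ C.derHom Y = C.derHom X ≫ C.bangHom f := C.der_natural f

theorem der_comp_cunit (X : C.Obj) : C.derHom X ≫ C.cunitHom X = 0 := C.der_cunit X

theorem der_comp_cmul (X : C.Obj) :
    C.derHom X ≫ C.cmulHom X =
      C.cmulHom X ▷ X ≫ (α_ _ _ _).hom ≫ C.bang X ◁ (β_ (C.bang X) X).hom ≫ (α_ _ _ _).inv ≫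
          C.derHom X ▷ C.bang X +
        C.cmulHom X ▷ X ≫ (α_ _ _ _).hom ≫ C.bang X ◁ C.derHom X := C.der_cmul X

theorem der_comp_eps (X : C.Obj) :
    C.derHom X ≫ C.epsHom X = C.cunitHom X ▷ X ≫ (λ_ X).hom := C.der_eps X

theorem der_comp_rho (X : C.Obj) :
    C.derHom X ≫ C.rhoHom X =
      C.cmulHom X ▷ X ≫ (α_ _ _ _).hom ≫ (C.rhoHom X ⊗ₘ C.derHom X) ≫ C.derHom (C.bang X) :=
  C.der_rho X

theorem tensor_m {X X' Y Y' : C.Obj} (f : X ⟶ X') (g : Y ⟶ Y') :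
    (C.bangHom f ⊗ₘ C.bangHom g) ≫ C.mHom X' Y' = C.mHom X Y ≫ C.bangHom (f ⊗ₘ g) :=
  C.m_natural f g

theorem whiskerRight_m_m (X Y Z : C.Obj) :
    C.mHom X Y ▷ C.bang Z ≫ C.mHom (X ⊗ Y) Z ≫ C.bangHom (α_ X Y Z).hom =
      (α_ _ _ _).hom ≫ C.bang X ◁ C.mHom Y Z ≫ C.mHom X (Y ⊗ Z) := C.m_assoc X Y Z

theorem mUnit_whiskerRight_m (X : C.Obj) :
    (λ_ (C.bang X)).inv ≫ C.mUnitHom ▷ C.bang X ≫ C.mHom (𝟙_ C.Obj) X ≫ C.bangHom (λ_ X).hom =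
      𝟙 (C.bang X) := C.m_unit_left X

theorem whiskerLeft_mUnit_m (X : C.Obj) :
    (ρ_ (C.bang X)).inv ≫ C.bang X ◁ C.mUnitHom ≫ C.mHom X (𝟙_ C.Obj) ≫ C.bangHom (ρ_ X).hom =
      𝟙 (C.bang X) := C.m_unit_right X

theorem braiding_m (X Y : C.Obj) :
    (β_ (C.bang X) (C.bang Y)).hom ≫ C.mHom Y X = C.mHom X Y ≫ C.bangHom (β_ X Y).hom := C.m_sw X Y

theorem m_comp_rho (X Y : C.Obj) :
    C.mHom X Y ≫ C.rhoHom (X ⊗ Y) =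
      (C.rhoHom X ⊗ₘ C.rhoHom Y) ≫ C.mHom (C.bang X) (C.bang Y) ≫ C.bangHom (C.mHom X Y) :=
  C.m_rho X Y

theorem m_comp_eps (X Y : C.Obj) : C.mHom X Y ≫ C.epsHom (X ⊗ Y) = C.epsHom X ⊗ₘ C.epsHom Y :=
  C.m_eps X Y

theorem m_comp_cmul (X Y : C.Obj) :
    C.mHom X Y ≫ C.cmulHom (X ⊗ Y) =
      (C.cmulHom X ⊗ₘ C.cmulHom Y) ≫ tensorμ _ _ _ _ ≫ (C.mHom X Y ⊗ₘ C.mHom X Y) := by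
  simp only [tensorμ, Category.assoc]
  exact C.m_cmul X Y

theorem mUnit_comp_eps : C.mUnitHom ≫ C.epsHom (𝟙_ C.Obj) = 𝟙 (𝟙_ C.Obj) := C.mUnit_eps

theorem mUnit_comp_cmul :
    C.mUnitHom ≫ C.cmulHom (𝟙_ C.Obj) = (λ_ (𝟙_ C.Obj)).inv ≫ (C.mUnitHom ⊗ₘ C.mUnitHom) :=
  C.mUnit_cmul

theorem mUnit_comp_cunit : C.mUnitHom ≫ C.cunitHom (𝟙_ C.Obj) = 𝟙 (𝟙_ C.Obj) := C.mUnit_cunit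

theorem rho_bang_map_cmul (X : C.Obj) :
    C.rhoHom X ≫ C.bangHom (C.cmulHom X) =
      C.cmulHom X ≫ (C.rhoHom X ⊗ₘ C.rhoHom X) ≫ C.mHom (C.bang X) (C.bang X) := C.cmul_coalg X

theorem rho_bang_map_cunit (X : C.Obj) :
    C.rhoHom X ≫ C.bangHom (C.cunitHom X) = C.cunitHom X ≫ C.mUnitHom := C.cunit_coalg X

end structureMaps

/-- The coderiving transformation. -/
def dcircHom (X : C.Obj) : C.bang X ⟶ C.bang X ⊗ X := C.cmulHom X ≫ C.bang X ◁ C.epsHom X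

/-- The deriving transformation at the unit. -/
def dRHom : C.bang (𝟙_ C.Obj) ⟶ C.bang (𝟙_ C.Obj) :=
  (ρ_ (C.bang (𝟙_ C.Obj))).inv ≫ C.derHom (𝟙_ C.Obj)

/-- The map `m_{R,X}`. -/
def mRAHom (X : C.Obj) : C.bang (𝟙_ C.Obj) ⊗ C.bang X ⟶ C.bang X :=
  C.mHom (𝟙_ C.Obj) X ≫ C.bangHom (λ_ X).hom

section derivative

variable {C}

/-- The derivative of `!X` in the direction of a point `x` of `X`. -/
def dirDer {X : C.Obj} (x : 𝟙_ C.Obj ⟶ X) : C.bang X ⟶ C.bang X :=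
  (ρ_ (C.bang X)).inv ≫ C.bang X ◁ x ≫ C.derHom X

theorem dirDer_id : dirDer (𝟙 (𝟙_ C.Obj)) = C.dRHom := by
  simp [dirDer, dRHom]

theorem dirDer_zero (X : C.Obj) : dirDer (0 : 𝟙_ C.Obj ⟶ X) = 0 := by
  simp [dirDer, whiskerLeft_zero_hom, zero_comp_hom, comp_zero_hom]

theorem dirDer_bangMap {X Y : C.Obj} (x : 𝟙_ C.Obj ⟶ X) (f : X ⟶ Y) :
    dirDer x ≫ C.bangHom f = C.bangHom f ≫ dirDer (x ≫ f) := by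
  simp only [dirDer, Category.assoc, ← tensor_der, tensorHom_def', whiskerLeft_comp]
  rw [whisker_exchange_assoc, whisker_exchange_assoc]
  simp

theorem dirDer_cunit {X : C.Obj} (x : 𝟙_ C.Obj ⟶ X) : dirDer x ≫ C.cunitHom X = 0 := by
  simp [dirDer, der_comp_cunit, comp_zero_hom]

theorem dirDer_eps {X : C.Obj} (x : 𝟙_ C.Obj ⟶ X) :
    dirDer x ≫ C.epsHom X = C.cunitHom X ≫ x := by
  simp only [dirDer, Category.assoc, der_comp_eps]
  rw [whisker_exchange_assoc]
  simp [unitors_equal]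

theorem dirDer_cmul {X : C.Obj} (x : 𝟙_ C.Obj ⟶ X) :
    dirDer x ≫ C.cmulHom X =
      C.cmulHom X ≫ dirDer x ▷ C.bang X + C.cmulHom X ≫ C.bang X ◁ dirDer x := by
  simp only [dirDer, Category.assoc, der_comp_cmul, comp_add_hom]
  congr 1
  · rw [whisker_exchange_assoc]
    simp only [tensor_whiskerLeft, Category.assoc, Iso.inv_hom_id_assoc,
      ← whiskerLeft_comp_assoc, BraidedCategory.braiding_naturality_right]
    simp only [comp_whiskerRight, whisker_assoc, Category.assoc, braiding_tensorUnit_right]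
    simp
  · rw [whisker_exchange_assoc]
    simp

theorem dirDer_rho {X : C.Obj} (x : 𝟙_ C.Obj ⟶ X) :
    dirDer x ≫ C.rhoHom X = C.cmulHom X ≫ (C.rhoHom X ⊗ₘ dirDer x) ≫ C.derHom (C.bang X) := by
  simp only [dirDer, Category.assoc, der_comp_rho, tensorHom_def']
  rw [whisker_exchange_assoc]
  simp

end derivative

section monoidalRule

variable {C}

/-- The chain rule for a morphism of cofree coalgebras. -/
theorem dirDer_comp_of_coalgebra {X Y : C.Obj} (x : 𝟙_ C.Obj ⟶ X) (u : C.bang X ⟶ C.bang Y)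
    (hu : u ≫ C.rhoHom Y = C.rhoHom X ≫ C.bangHom u) :
    dirDer x ≫ u = C.cmulHom X ≫ (u ⊗ₘ (dirDer x ≫ u ≫ C.epsHom Y)) ≫ C.derHom Y := by
  have hu' : u = C.rhoHom X ≫ C.bangHom (u ≫ C.epsHom Y) := by
    rw [← bang_map_comp, ← reassoc_of% hu, rho_comp_bang_map_eps, Category.comp_id]
  calc dirDer x ≫ u
      = (dirDer x ≫ C.rhoHom X) ≫ C.bangHom (u ≫ C.epsHom Y) := by
        rw [Category.assoc, ← hu']
    _ = C.cmulHom X ≫ ((C.rhoHom X ≫ C.bangHom (u ≫ C.epsHom Y)) ⊗ₘ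
          (dirDer x ≫ u ≫ C.epsHom Y)) ≫ C.derHom Y := by
        rw [dirDer_rho, Category.assoc, Category.assoc, ← tensor_der,
          tensorHom_comp_tensorHom_assoc]
    _ = _ := by rw [← hu']

theorem dirDer_pair {X Y Z : C.Obj} (x : 𝟙_ C.Obj ⟶ X) (f : X ⟶ Y) (g : X ⟶ Z)
    (hg : x ≫ g = 0) :
    dirDer x ≫ C.cmulHom X ≫ (C.bangHom f ⊗ₘ C.bangHom g) =
      C.cmulHom X ≫ (C.bangHom f ⊗ₘ C.bangHom g) ≫ dirDer (x ≫ f) ▷ C.bang Z := by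
  rw [← Category.assoc, dirDer_cmul, add_comp_hom]
  have h1 : C.bang X ◁ dirDer x ≫ (C.bangHom f ⊗ₘ C.bangHom g) = 0 := by
    rw [tensorHom_def', ← whiskerLeft_comp_assoc, dirDer_bangMap, hg, dirDer_zero,
      comp_zero_hom, whiskerLeft_zero_hom, zero_comp_hom]
  rw [Category.assoc, Category.assoc, h1, comp_zero_hom, _root_.add_zero,
    MonoidalCategory.tensorHom_def,
    ← comp_whiskerRight_assoc, dirDer_bangMap]
  simp [whisker_exchange]

theorem pair_comp_m_comp_rho {X Y Z : C.Obj} (f : X ⟶ Y) (g : X ⟶ Z) :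
    (C.cmulHom X ≫ (C.bangHom f ⊗ₘ C.bangHom g) ≫ C.mHom Y Z) ≫ C.rhoHom (Y ⊗ Z) =
      C.rhoHom X ≫ C.bangHom (C.cmulHom X ≫ (C.bangHom f ⊗ₘ C.bangHom g) ≫ C.mHom Y Z) := by
  simp only [← bang_map_comp, Category.assoc, m_comp_rho, tensorHom_comp_tensorHom_assoc,
    bang_map_rho]
  rw [reassoc_of% (rho_bang_map_cmul X), ← reassoc_of% (tensor_m (C.bangHom f) (C.bangHom g)),
    tensorHom_comp_tensorHom_assoc]

theorem pair_comp_mRA_comp_rho {X Y : C.Obj} (f : X ⟶ 𝟙_ C.Obj) (g : X ⟶ Y) :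
    (C.cmulHom X ≫ (C.bangHom f ⊗ₘ C.bangHom g) ≫ C.mRAHom Y) ≫ C.rhoHom Y =
      C.rhoHom X ≫ C.bangHom (C.cmulHom X ≫ (C.bangHom f ⊗ₘ C.bangHom g) ≫ C.mRAHom Y) := by
  have h := pair_comp_m_comp_rho f g
  simp only [Category.assoc, ← bang_map_comp] at h
  simp only [mRAHom, Category.assoc, bang_map_rho, ← bang_map_comp]
  rw [reassoc_of% h]

theorem mRA_comp_eps (X : C.Obj) :
    C.mRAHom X ≫ C.epsHom X = (C.epsHom (𝟙_ C.Obj) ⊗ₘ C.epsHom X) ≫ (λ_ X).hom := by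
  rw [mRAHom, Category.assoc, bang_map_eps, ← m_comp_eps, Category.assoc]

theorem dR_comp_eps : C.dRHom ≫ C.epsHom (𝟙_ C.Obj) = C.cunitHom (𝟙_ C.Obj) := by
  rw [← dirDer_id, dirDer_eps, Category.comp_id]

/-- The coalgebra structure of `!X ⊗ !Y`. -/
def tensorCoalg (X Y : C.Obj) : C.bang X ⊗ C.bang Y ⟶ C.bang (C.bang X ⊗ C.bang Y) :=
  (C.rhoHom X ⊗ₘ C.rhoHom Y) ≫ C.mHom (C.bang X) (C.bang Y)

/-- The linear projection of `!X ⊗ !Y` onto `X`. -/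
def linFst (X Y : C.Obj) : C.bang X ⊗ C.bang Y ⟶ X :=
  (C.epsHom X ⊗ₘ C.cunitHom Y) ≫ (ρ_ X).hom

/-- The linear projection of `!X ⊗ !Y` onto `Y`. -/
def linSnd (X Y : C.Obj) : C.bang X ⊗ C.bang Y ⟶ Y :=
  (C.cunitHom X ⊗ₘ C.epsHom Y) ≫ (λ_ Y).hom

theorem tensorCoalg_linFst (X Y : C.Obj) :
    tensorCoalg X Y ≫ C.bangHom (linFst X Y) = C.bang X ◁ C.cunitHom Y ≫ (ρ_ _).hom := by
  rw [tensorCoalg, linFst, ← bang_map_comp, Category.assoc, ← reassoc_of% tensor_m,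
    tensorHom_comp_tensorHom_assoc, rho_comp_bang_map_eps, rho_bang_map_cunit, id_tensorHom,
    whiskerLeft_comp_assoc]
  have h := whiskerLeft_mUnit_m X
  rw [Iso.inv_comp_eq, Category.comp_id] at h
  rw [h]

theorem tensorCoalg_linSnd (X Y : C.Obj) :
    tensorCoalg X Y ≫ C.bangHom (linSnd X Y) = C.cunitHom X ▷ C.bang Y ≫ (λ_ _).hom := by
  rw [tensorCoalg, linSnd, ← bang_map_comp, Category.assoc, ← reassoc_of% tensor_m,
    tensorHom_comp_tensorHom_assoc, rho_comp_bang_map_eps, rho_bang_map_cunit, tensorHom_id,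
    comp_whiskerRight_assoc]
  have h := mUnit_whiskerRight_m Y
  rw [Iso.inv_comp_eq, Category.comp_id] at h
  rw [h]

theorem tensorCoalg_cmul (X Y : C.Obj) :
    tensorCoalg X Y ≫ C.cmulHom (C.bang X ⊗ C.bang Y) =
      (C.cmulHom X ⊗ₘ C.cmulHom Y) ≫ tensorμ _ _ _ _ ≫
        (tensorCoalg X Y ⊗ₘ tensorCoalg X Y) := by
  rw [tensorCoalg, Category.assoc, m_comp_cmul, tensorHom_comp_tensorHom_assoc, rho_comp_cmul,
    rho_comp_cmul, ← tensorHom_comp_tensorHom_assoc, tensorμ_natural_assoc,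
    tensorHom_comp_tensorHom]

theorem braiding_unit_unit : (β_ (𝟙_ C.Obj) (𝟙_ C.Obj)).hom = 𝟙 _ := by
  rw [braiding_tensorUnit_left, unitors_equal, Iso.hom_inv_id]

theorem tensorCoalg_pair (X Y : C.Obj) :
    tensorCoalg X Y ≫ C.cmulHom _ ≫
      (C.bangHom (linFst X Y) ⊗ₘ C.bangHom (linSnd X Y)) = 𝟙 _ := by
  rw [reassoc_of% (tensorCoalg_cmul X Y), tensorHom_comp_tensorHom, tensorCoalg_linFst,
    tensorCoalg_linSnd, ← tensorHom_comp_tensorHom, ← id_tensorHom, ← tensorHom_id,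
    ← tensorμ_natural_assoc, tensorHom_comp_tensorHom_assoc, id_tensorHom, tensorHom_id]
  have h : tensorμ (C.bang X) (𝟙_ C.Obj) (𝟙_ C.Obj) (C.bang Y) ≫
      ((ρ_ (C.bang X)).hom ⊗ₘ (λ_ (C.bang Y)).hom) =
      (ρ_ (C.bang X)).hom ⊗ₘ (λ_ (C.bang Y)).hom := by
    simp only [tensorμ, braiding_unit_unit, id_whiskerRight, whiskerLeft_id, Category.id_comp,
      Category.assoc]
    monoidal
  rw [h, tensorHom_comp_tensorHom, Category.assoc, Category.assoc, cmul_cunit_right,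
    cmul_cunit_left, id_tensorHom_id]

/-- The monoidal rule for the deriving transformation at the unit. -/
theorem dR_whiskerRight_mRA (X : C.Obj) :
    C.dRHom ▷ C.bang X ≫ C.mRAHom X =
      C.bang (𝟙_ C.Obj) ◁ C.dcircHom X ≫ (α_ _ _ _).inv ≫ C.mRAHom X ▷ X ≫ C.derHom X := by
  let f := linFst (𝟙_ C.Obj) X
  let g := linSnd (𝟙_ C.Obj) X
  let x : 𝟙_ C.Obj ⟶ C.bang (𝟙_ C.Obj) ⊗ C.bang X :=
    (λ_ _).inv ≫ ((C.mUnitHom ≫ C.dRHom) ⊗ₘ (C.mUnitHom ≫ C.bangHom (0 : 𝟙_ C.Obj ⟶ X)))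
  have hf : x ≫ f = 𝟙 _ := by
    simp only [x, f, linFst, Category.assoc, tensorHom_comp_tensorHom_assoc, bang_map_cunit,
      mUnit_comp_cunit, dR_comp_eps, id_tensorHom_id]
    rw [Category.id_comp, ← unitors_equal, Iso.inv_hom_id]
  have hg : x ≫ g = 0 := by
    simp only [x, g, linSnd, Category.assoc, tensorHom_comp_tensorHom_assoc]
    rw [← dirDer_id, dirDer_cunit, comp_zero_hom,
      MonoidalCategory.tensorHom_def, zero_whiskerRight_hom,
      zero_comp_hom, zero_comp_hom, comp_zero_hom]
  have hpair := dirDer_pair x f g hg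
  rw [hf, dirDer_id] at hpair
  have hω : tensorCoalg (𝟙_ C.Obj) X ≫ C.cmulHom _ ≫ (C.bangHom f ⊗ₘ C.bangHom g) = 𝟙 _ :=
    tensorCoalg_pair (𝟙_ C.Obj) X
  have hchain := dirDer_comp_of_coalgebra x _ (pair_comp_mRA_comp_rho f g)
  have hdir : dirDer x ≫ (C.cmulHom _ ≫ (C.bangHom f ⊗ₘ C.bangHom g) ≫ C.mRAHom X) ≫
      C.epsHom X = C.bangHom g ≫ C.epsHom X := by
    rw [Category.assoc, Category.assoc, mRA_comp_eps, reassoc_of% hpair,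
      ← tensorHom_id, tensorHom_comp_tensorHom_assoc, tensorHom_comp_tensorHom_assoc,
      Category.assoc, dR_comp_eps, Category.comp_id, bang_map_cunit, MonoidalCategory.tensorHom_def]
    have h := cmul_cunit_left (C.bang (𝟙_ C.Obj) ⊗ C.bang X)
    simp only [Category.assoc, leftUnitor_naturality]
    rw [reassoc_of% h]
  rw [hdir, reassoc_of% hpair] at hchain
  have h := congrArg (tensorCoalg (𝟙_ C.Obj) X ≫ ·) hchain
  rw [reassoc_of% hω] at h
  rw [h]
  have hsplit : C.cmulHom (C.bang (𝟙_ C.Obj) ⊗ C.bang X) ≫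
      ((C.cmulHom (C.bang (𝟙_ C.Obj) ⊗ C.bang X) ≫ (C.bangHom f ⊗ₘ C.bangHom g)) ⊗ₘ
        C.bangHom g) = C.cmulHom _ ≫ (C.bangHom f ⊗ₘ C.bangHom g) ≫
          C.bang (𝟙_ C.Obj) ◁ C.cmulHom X ≫ (α_ _ _ _).inv := by
    rw [← id_tensorHom, tensorHom_comp_tensorHom_assoc, bang_map_cmul, Category.comp_id]
    have h' := cmul_assoc (C.bang (𝟙_ C.Obj) ⊗ C.bang X)
    have : (C.bangHom f ⊗ₘ (C.cmulHom _ ≫ (C.bangHom g ⊗ₘ C.bangHom g))) =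
      C.bang (C.bang (𝟙_ C.Obj) ⊗ C.bang X) ◁ C.cmulHom _ ≫
        (C.bangHom f ⊗ₘ (C.bangHom g ⊗ₘ C.bangHom g)) := by
      rw [← id_tensorHom, tensorHom_comp_tensorHom, Category.id_comp]
    rw [this, Category.assoc, ← reassoc_of% h', associator_inv_naturality,
      Iso.hom_inv_id_assoc, ← tensorHom_id, tensorHom_comp_tensorHom, Category.id_comp]
  have hgoal : (C.cmulHom (C.bang (𝟙_ C.Obj) ⊗ C.bang X) ≫
      (C.bangHom f ⊗ₘ C.bangHom g) ≫ C.mRAHom X) ⊗ₘ (C.bangHom g ≫ C.epsHom X) =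
      ((C.cmulHom (C.bang (𝟙_ C.Obj) ⊗ C.bang X) ≫ (C.bangHom f ⊗ₘ C.bangHom g)) ⊗ₘ
        C.bangHom g) ≫ (C.mRAHom X ⊗ₘ C.epsHom X) := by
    rw [tensorHom_comp_tensorHom, Category.assoc]
  rw [hgoal, Category.assoc, reassoc_of% hsplit, reassoc_of% hω, dcircHom, tensorHom_def']
  simp

end monoidalRule

section action

variable {C}

/-- The action on `!X` of a point of `!R`. -/
def act (a : 𝟙_ C.Obj ⟶ C.bang (𝟙_ C.Obj)) (X : C.Obj) : C.bang X ⟶ C.bang X :=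
  (λ_ (C.bang X)).inv ≫ a ▷ C.bang X ≫ C.mRAHom X

theorem act_mUnit (X : C.Obj) : act C.mUnitHom X = 𝟙 _ := mUnit_whiskerRight_m X

theorem act_add (a b : 𝟙_ C.Obj ⟶ C.bang (𝟙_ C.Obj)) (X : C.Obj) :
    act (a + b) X = act a X + act b X := by
  simp only [act, add_whiskerRight_hom, add_comp_hom, comp_add_hom]

theorem whiskerLeft_mRA_mRA (X : C.Obj) :
    C.bang (𝟙_ C.Obj) ◁ C.mRAHom X ≫ C.mRAHom X =
      (α_ _ _ _).inv ≫ C.mRAHom (𝟙_ C.Obj) ▷ C.bang X ≫ C.mRAHom X := by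
  have hl := tensor_m (𝟙 (𝟙_ C.Obj)) (λ_ X).hom
  have hr := tensor_m (λ_ (𝟙_ C.Obj)).hom (𝟙 X)
  rw [bang_map_id, id_tensorHom, id_tensorHom] at hl
  rw [bang_map_id, tensorHom_id, tensorHom_id] at hr
  have hcoh : (λ_ (𝟙_ C.Obj)).hom ▷ X = (α_ _ _ _).hom ≫ 𝟙_ C.Obj ◁ (λ_ X).hom := by
    rw [triangle, unitors_equal]
  simp only [mRAHom, whiskerLeft_comp, comp_whiskerRight, Category.assoc]
  rw [reassoc_of% hl, reassoc_of% hr, hcoh, ← bang_map_comp, Category.assoc,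
    reassoc_of% (whiskerRight_m_m (𝟙_ C.Obj) (𝟙_ C.Obj) X), Iso.inv_hom_id_assoc]

theorem comp_act_unit (a b : 𝟙_ C.Obj ⟶ C.bang (𝟙_ C.Obj)) :
    a ≫ act b (𝟙_ C.Obj) = (λ_ _).inv ≫ (b ⊗ₘ a) ≫ C.mRAHom (𝟙_ C.Obj) := by
  rw [act, leftUnitor_inv_naturality_assoc, tensorHom_def'_assoc]

theorem act_comp_act (a b : 𝟙_ C.Obj ⟶ C.bang (𝟙_ C.Obj)) (X : C.Obj) :
    act a X ≫ act b X = act (a ≫ act b (𝟙_ C.Obj)) X := by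
  have h : C.mRAHom X ≫ (λ_ _).inv ≫ b ▷ C.bang X ≫ C.mRAHom X =
      (λ_ _).inv ≫ b ▷ _ ≫ (α_ _ _ _).inv ≫ C.mRAHom (𝟙_ C.Obj) ▷ C.bang X ≫ C.mRAHom X := by
    rw [leftUnitor_inv_naturality_assoc, whisker_exchange_assoc, whiskerLeft_mRA_mRA]
  rw [comp_act_unit, act, act, act, tensorHom_def']
  simp only [Category.assoc, h]
  simp

theorem act_comm (a b : 𝟙_ C.Obj ⟶ C.bang (𝟙_ C.Obj)) (X : C.Obj) :
    act a X ≫ act b X = act b X ≫ act a X := by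
  have hμ : (β_ (C.bang (𝟙_ C.Obj)) (C.bang (𝟙_ C.Obj))).hom ≫ C.mRAHom (𝟙_ C.Obj) =
      C.mRAHom (𝟙_ C.Obj) := by
    rw [mRAHom, reassoc_of% braiding_m, braiding_unit_unit, bang_map_id, Category.id_comp]
  have h : (b ⊗ₘ a) ≫ C.mRAHom (𝟙_ C.Obj) = (a ⊗ₘ b) ≫ C.mRAHom (𝟙_ C.Obj) := by
    rw [← hμ, BraidedCategory.braiding_naturality_assoc, braiding_unit_unit, Category.id_comp, hμ]
  rw [act_comp_act, act_comp_act, comp_act_unit, comp_act_unit, h]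

theorem act_comp (a : 𝟙_ C.Obj ⟶ C.bang (𝟙_ C.Obj)) (s : C.bang (𝟙_ C.Obj) ⟶ C.bang (𝟙_ C.Obj))
    (X : C.Obj) :
    act (a ≫ s) X = (λ_ _).inv ≫ a ▷ C.bang X ≫ s ▷ C.bang X ≫ C.mRAHom X := by
  rw [act, comp_whiskerRight, Category.assoc]

theorem act_tensor_comp (a : 𝟙_ C.Obj ⟶ C.bang (𝟙_ C.Obj))
    (s t : C.bang (𝟙_ C.Obj) ⟶ C.bang (𝟙_ C.Obj)) (X : C.Obj) :
    act ((λ_ _).inv ≫ (a ≫ s ⊗ₘ a ≫ s) ≫ C.mRAHom (𝟙_ C.Obj) ≫ t) X =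
      ((λ_ (C.bang X)).inv ≫ (λ_ (𝟙_ C.Obj ⊗ C.bang X)).inv) ≫
        (a ⊗ₘ (a ⊗ₘ 𝟙 (C.bang X))) ≫ (s ⊗ₘ (s ⊗ₘ 𝟙 (C.bang X))) ≫ (α_ _ _ _).inv ≫
          C.mRAHom (𝟙_ C.Obj) ▷ C.bang X ≫ t ▷ C.bang X ≫ C.mRAHom X := by
  rw [tensorHom_comp_tensorHom_assoc, tensorHom_comp_tensorHom, Category.comp_id,
    associator_inv_naturality_assoc, tensorHom_id, act]
  simp

theorem dcirc_act_whiskerRight (a : 𝟙_ C.Obj ⟶ C.bang (𝟙_ C.Obj))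
    (s : C.bang (𝟙_ C.Obj) ⟶ C.bang (𝟙_ C.Obj)) (X : C.Obj) :
    C.dcircHom X ≫ act (a ≫ s) X ▷ X =
      (λ_ (C.bang X)).inv ≫ a ▷ C.bang X ≫ (s ⊗ₘ C.dcircHom X) ≫ (α_ _ _ _).inv ≫
        C.mRAHom X ▷ X := by
  rw [tensorHom_def_assoc, ← comp_whiskerRight_assoc, ← whisker_exchange_assoc,
    ← leftUnitor_inv_naturality_assoc, act]
  simp

theorem dcirc_act_der (w : 𝟙_ C.Obj ⟶ C.bang (𝟙_ C.Obj)) (X : C.Obj) :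
    C.dcircHom X ≫ act w X ▷ X ≫ C.derHom X = act (w ≫ C.dRHom) X := by
  simp only [act, comp_whiskerRight, Category.assoc]
  rw [dR_whiskerRight_mRA, ← whisker_exchange_assoc, ← leftUnitor_inv_naturality_assoc]
  simp

theorem dcirc_der (X : C.Obj) :
    C.dcircHom X ≫ C.derHom X = act (C.mUnitHom ≫ C.dRHom) X := by
  rw [← dcirc_act_der, act_mUnit, id_whiskerRight, Category.id_comp]

end action

section antiderivative

variable {C}

theorem dcirc_der_dcirc (X : C.Obj) :
    C.dcircHom X ≫ C.derHom X ≫ C.dcircHom X =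
      C.dcircHom X ≫ (C.dcircHom X ≫ C.derHom X + 𝟙 _) ▷ X := by
  rw [add_whiskerRight_hom, comp_add_hom]
  simp only [dcircHom, reassoc_of% (der_comp_cmul X), add_comp_hom, comp_add_hom,
    Category.assoc]
  congr 1
  · have hc : C.cmulHom X ≫ C.cmulHom X ▷ C.bang X ≫ (α_ _ _ _).hom ≫
        C.bang X ◁ (β_ (C.bang X) (C.bang X)).hom =
        C.cmulHom X ≫ C.cmulHom X ▷ C.bang X ≫ (α_ _ _ _).hom := by
      rw [reassoc_of% (cmul_assoc X), ← whiskerLeft_comp, cmul_braiding, cmul_assoc]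
    rw [← whisker_exchange, whisker_exchange_assoc]
    simp only [tensor_whiskerLeft, Category.assoc, Iso.inv_hom_id_assoc,
      ← whiskerLeft_comp_assoc, BraidedCategory.braiding_naturality_right_assoc]
    simp only [whiskerLeft_comp, Category.assoc]
    rw [reassoc_of% hc]
    simp only [comp_whiskerRight, whisker_assoc, Category.assoc]
    rw [whisker_exchange_assoc (C.cmulHom X) (C.epsHom X), tensor_whiskerLeft]
    simp only [Category.assoc, Iso.inv_hom_id_assoc, ← whiskerLeft_comp_assoc, whisker_exchange]
  · have h := congrArg (· ▷ X) (cmul_cunit_right X)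
    simp only [comp_whiskerRight, id_whiskerRight, whisker_assoc, Category.assoc,
      ← triangle, Iso.inv_hom_id_assoc] at h
    rw [← whiskerLeft_comp, der_comp_eps, whiskerLeft_comp, h, id_whiskerRight]

theorem bang_zero_dcirc (X : C.Obj) : C.bangHom (0 : X ⟶ X) ≫ C.dcircHom X = 0 := by
  rw [dcircHom, reassoc_of% bang_map_cmul, ← id_tensorHom, tensorHom_comp_tensorHom,
    bang_map_eps, comp_zero_hom, tensorHom_def', whiskerLeft_zero_hom, zero_comp_hom,
    comp_zero_hom]

theorem der_bang_zero (X : C.Obj) : C.derHom X ≫ C.bangHom (0 : X ⟶ X) = 0 := by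
  rw [← tensor_der, tensorHom_def', whiskerLeft_zero_hom, zero_comp_hom, zero_comp_hom]

variable (C) in
/-- The transformation `K`. -/
def KHom (X : C.Obj) : C.bang X ⟶ C.bang X :=
  C.dcircHom X ≫ C.derHom X + C.bangHom (0 : X ⟶ X)

variable (C) in
/-- The transformation `J`. -/
def JHom (X : C.Obj) : C.bang X ⟶ C.bang X := C.dcircHom X ≫ C.derHom X + 𝟙 _

theorem K_dcirc (X : C.Obj) : C.KHom X ≫ C.dcircHom X = C.dcircHom X ≫ C.JHom X ▷ X := by
  rw [KHom, add_comp_hom, bang_zero_dcirc, _root_.add_zero, Category.assoc, dcirc_der_dcirc, JHom]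

theorem K_bang_zero (X : C.Obj) :
    C.KHom X ≫ C.bangHom (0 : X ⟶ X) = C.bangHom (0 : X ⟶ X) := by
  rw [KHom, add_comp_hom, Category.assoc, der_bang_zero, comp_zero_hom, _root_.zero_add,
    bang_map_comp, comp_zero_hom]

theorem mUnit_dcirc :
    C.mUnitHom ≫ C.dcircHom (𝟙_ C.Obj) ≫ (ρ_ _).hom = C.mUnitHom := by
  rw [dcircHom, Category.assoc, reassoc_of% mUnit_comp_cmul (C := C), ← id_tensorHom,
    tensorHom_comp_tensorHom_assoc, mUnit_comp_eps, Category.comp_id, tensorHom_id,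
    rightUnitor_naturality, ← unitors_equal, Iso.inv_hom_id_assoc]

variable {Kinv : ∀ X : C.Obj, C.bang X ⟶ C.bang X}

theorem Kinv_dcirc_J {X : C.Obj} (hK : Kinv X ≫ C.KHom X = 𝟙 _) :
    Kinv X ≫ C.dcircHom X ≫ C.JHom X ▷ X = C.dcircHom X := by
  rw [← K_dcirc, reassoc_of% hK]

variable (Kinv) in
/-- The point `m_R s_R` of `!R`. -/
def intPoint : 𝟙_ C.Obj ⟶ C.bang (𝟙_ C.Obj) :=
  C.mUnitHom ≫ Kinv (𝟙_ C.Obj) ≫ C.dcircHom (𝟙_ C.Obj) ≫ (ρ_ _).hom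

theorem intPoint_J (hK : Kinv (𝟙_ C.Obj) ≫ C.KHom (𝟙_ C.Obj) = 𝟙 _) :
    intPoint Kinv ≫ C.JHom (𝟙_ C.Obj) = C.mUnitHom := by
  rw [intPoint, Category.assoc, Category.assoc, Category.assoc, ← rightUnitor_naturality,
    reassoc_of% (Kinv_dcirc_J hK), mUnit_dcirc]

theorem act_intPoint_J (hK : Kinv (𝟙_ C.Obj) ≫ C.KHom (𝟙_ C.Obj) = 𝟙 _) (X : C.Obj) :
    act (intPoint Kinv) X ≫ C.JHom X = 𝟙 _ := by
  have h := intPoint_J hK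
  rw [JHom, dcirc_der, comp_add_hom, Category.comp_id] at h
  rw [JHom, dcirc_der, comp_add_hom, Category.comp_id, act_comp_act, ← act_add, h, act_mUnit]

theorem J_act_intPoint (hK : Kinv (𝟙_ C.Obj) ≫ C.KHom (𝟙_ C.Obj) = 𝟙 _) (X : C.Obj) :
    C.JHom X ≫ act (intPoint Kinv) X = 𝟙 _ := by
  rw [← act_intPoint_J hK X, JHom, dcirc_der, comp_add_hom, add_comp_hom, act_comm,
    Category.comp_id, Category.id_comp]

theorem Kinv_dcirc (hK : ∀ X, Kinv X ≫ C.KHom X = 𝟙 _) (X : C.Obj) :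
    Kinv X ≫ C.dcircHom X = C.dcircHom X ≫ act (intPoint Kinv) X ▷ X := by
  rw [← Kinv_dcirc_J (hK X), Category.assoc, Category.assoc, ← comp_whiskerRight,
    J_act_intPoint (hK _), id_whiskerRight, Category.comp_id, Kinv_dcirc_J (hK X)]

theorem Kinv_eq (hK : ∀ X, Kinv X ≫ C.KHom X = 𝟙 _) (X : C.Obj) :
    Kinv X = act ((λ_ _).inv ≫ (intPoint Kinv ⊗ₘ intPoint Kinv) ≫ C.mRAHom (𝟙_ C.Obj) ≫
      C.dRHom) X + C.bangHom (0 : X ⟶ X) := by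
  have hzero : Kinv X ≫ C.bangHom (0 : X ⟶ X) = C.bangHom (0 : X ⟶ X) := by
    rw [← K_bang_zero, reassoc_of% (hK X), K_bang_zero]
  have hone : Kinv X ≫ C.dcircHom X ≫ C.derHom X + C.bangHom (0 : X ⟶ X) = 𝟙 _ := by
    rw [← hK X, KHom, comp_add_hom, hzero]
  have hw := comp_act_unit (intPoint Kinv) (intPoint Kinv)
  have hd := reassoc_of% (Kinv_dcirc hK X)
  calc Kinv X = Kinv X ≫ (Kinv X ≫ C.dcircHom X ≫ C.derHom X + C.bangHom (0 : X ⟶ X)) := by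
        rw [hone, Category.comp_id]
    _ = C.dcircHom X ≫ (act (intPoint Kinv) X ≫ act (intPoint Kinv) X) ▷ X ≫ C.derHom X +
          C.bangHom (0 : X ⟶ X) := by
        rw [comp_add_hom, hzero, hd, hd, comp_whiskerRight, Category.assoc]
    _ = _ := by
        rw [act_comp_act, dcirc_act_der, hw, Category.assoc, Category.assoc]

end antiderivative

end DiffLinCat
/-- Corollary: in a differential linear category with antiderivatives,
K⁻¹, J⁻¹ and the antiderivative integral transformation s are determined by
s_R, via the formulas
(i) K_A⁻¹ = (m_R ⊗ m_R ⊗ 1)(s_R ⊗ s_R ⊗ 1)(m_{R,R} ⊗ 1)(d_R ⊗ 1) m_{R,A} + !(0),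
(ii) J_A⁻¹ = (m_R ⊗ 1)(s_R ⊗ 1) m_{R,A},
(iii) s_A = (m_R ⊗ 1)(s_R ⊗ d°_A)(m_{R,A} ⊗ 1_A). -/
theorem statement15 (C : DiffLinCat)
    (Kinv : ∀ A : C.Obj, C.Hom (C.bang A) (C.bang A))
    (hK1 : ∀ A : C.Obj, C.comp (C.K A) (Kinv A) = C.id (C.bang A))
    (hK2 : ∀ A : C.Obj, C.comp (Kinv A) (C.K A) = C.id (C.bang A))
    (A : C.Obj) :
    (Kinv A =
      C.add
        (C.comp
          (C.cHom ((C.unit_ten (C.bang A)).symm.trans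
            (congrArg (C.ten C.unit) (C.unit_ten (C.bang A)).symm)))
          (C.comp (C.tHom C.mUnit (C.tHom C.mUnit (C.id (C.bang A))))
            (C.comp (C.tHom (C.sRof Kinv) (C.tHom (C.sRof Kinv) (C.id (C.bang A))))
              (C.comp (C.cHom (C.tenAssoc (C.bang C.unit) (C.bang C.unit) (C.bang A)).symm)
                (C.comp (C.tHom C.mRR (C.id (C.bang A)))
                  (C.comp (C.tHom C.dR (C.id (C.bang A))) (C.mRA A)))))))
        (C.bangMap (C.zero : C.Hom A A))) ∧
    (C.comp (C.J A)
        (C.comp (C.cHom (C.unit_ten (C.bang A)).symm)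
          (C.comp (C.tHom C.mUnit (C.id (C.bang A)))
            (C.comp (C.tHom (C.sRof Kinv) (C.id (C.bang A))) (C.mRA A)))) =
      C.id (C.bang A)) ∧
    (C.comp
        (C.comp (C.cHom (C.unit_ten (C.bang A)).symm)
          (C.comp (C.tHom C.mUnit (C.id (C.bang A)))
            (C.comp (C.tHom (C.sRof Kinv) (C.id (C.bang A))) (C.mRA A))))
        (C.J A) =
      C.id (C.bang A)) ∧
    (C.comp (Kinv A) (C.dcirc A) =
      C.comp (C.cHom (C.unit_ten (C.bang A)).symm)
        (C.comp (C.tHom C.mUnit (C.id (C.bang A)))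
          (C.comp (C.tHom (C.sRof Kinv) (C.dcirc A))
            (C.comp (C.cHom (C.tenAssoc (C.bang C.unit) (C.bang A) A).symm)
              (C.tHom (C.mRA A) (C.id A)))))) := by
  let K' : ∀ X : C.Obj, C.bang X ⟶ C.bang X := Kinv
  have hK : ∀ X, K' X ≫ C.KHom X = 𝟙 _ := hK2
  let s : C.bang (𝟙_ C.Obj) ⟶ C.bang (𝟙_ C.Obj) := C.sRof Kinv
  have hact := DiffLinCat.act_comp C.mUnitHom s A
  refine ⟨?_, ?_, ?_, ?_⟩
  · refine (DiffLinCat.Kinv_eq hK A).trans ?_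
    refine congrArg (· + C.bangHom (0 : A ⟶ A)) ?_
    refine (DiffLinCat.act_tensor_comp C.mUnitHom s C.dRHom A).trans ?_
    refine congrArg (· ≫ _) ?_
    simp only [DiffLinCat.leftUnitor_inv_eq_eqToHom, eqToHom_trans]
    exact (C.cHom_eq_eqToHom _).symm
  · refine (congrArg (C.comp (C.J A)) hact.symm).trans ?_
    exact DiffLinCat.J_act_intPoint (hK _) A
  · refine (congrArg (C.comp · (C.J A)) hact.symm).trans ?_
    exact DiffLinCat.act_intPoint_J (hK _) A
  · exact (DiffLinCat.Kinv_dcirc hK A).trans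
      (DiffLinCat.dcirc_act_whiskerRight C.mUnitHom s A)
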